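/- T_{max,2}(18) = 86 and T_{max,3}(18) = 102; in particular, for l = 18 the function m1 ↦ T_{max,m1}(18) is strictly increasing on {1, 2, 3}. -/

import Mathlib

open MvPolynomial

/-- A monomial ideal: an ideal containing the monomials of all its elements. -/
def IsMonomialIdeal (I : Ideal (MvPolynomial (Fin 3) ℂ)) : Prop :=
  ∀ p ∈ I, ∀ d ∈ p.support, (monomial d (1 : ℂ)) ∈ I

/-- Borel-fixed (strongly stable) in characteristic 0: for every monomial in `I`
divisible by `x_j`, and every `i < j`, replacing one factor `x_j` by `x_i`
stays in `I`. -/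
def IsBorelFixed (I : Ideal (MvPolynomial (Fin 3) ℂ)) : Prop :=
  ∀ d : Fin 3 →₀ ℕ, (monomial d (1 : ℂ)) ∈ I →
    ∀ i j : Fin 3, i < j → 0 < d j →
      (monomial (d + Finsupp.single i 1 - Finsupp.single j 1) (1 : ℂ)) ∈ I

/-- The dimension of the tangent space to the Hilbert scheme at `[I]`,
namely `dim_ℂ Hom_R(I, R/I)`. -/
noncomputable def tangentDim (I : Ideal (MvPolynomial (Fin 3) ℂ)) : ℕ :=
  Module.finrank ℂ (↥I →ₗ[MvPolynomial (Fin 3) ℂ] (MvPolynomial (Fin 3) ℂ ⧸ I))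

/-- `TmaxEq l m1 T` says that `T` is the maximum of `dim_ℂ Hom_R(I, R/I)` over all
Borel-fixed monomial ideals `I ⊆ ℂ[x,y,z]` of colength `l` whose smallest pure power
of `x` lying in `I` is `x^{m1}`. -/
def TmaxEq (l m1 T : ℕ) : Prop :=
  IsGreatest { t : ℕ | ∃ I : Ideal (MvPolynomial (Fin 3) ℂ),
      IsMonomialIdeal I ∧ IsBorelFixed I ∧
      Module.finrank ℂ (MvPolynomial (Fin 3) ℂ ⧸ I) = l ∧
      (X 0 : MvPolynomial (Fin 3) ℂ) ^ m1 ∈ I ∧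
      (X 0 : MvPolynomial (Fin 3) ℂ) ^ (m1 - 1) ∉ I ∧
      t = tangentDim I } T

section MonomialIdeal

variable {I : Ideal (MvPolynomial (Fin 3) ℂ)}

theorem IsMonomialIdeal.coeff_eq_zero (hI : IsMonomialIdeal I) {s : Fin 3 →₀ ℕ}
    (hs : monomial s (1 : ℂ) ∉ I) {f : MvPolynomial (Fin 3) ℂ} (hf : f ∈ I) : coeff s f = 0 := by
  by_contra h
  exact hs (hI f hf s (mem_support_iff.2 h))

theorem mem_of_forall_monomial_mem (J : Ideal (MvPolynomial (Fin 3) ℂ))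
    {f : MvPolynomial (Fin 3) ℂ} (h : ∀ d ∈ f.support, monomial d (1 : ℂ) ∈ J) : f ∈ J := by
  rw [← support_sum_monomial_coeff f]
  refine Ideal.sum_mem _ fun d hd => ?_
  have := J.mul_mem_left (C (coeff d f)) (h d hd)
  rwa [C_mul_monomial, mul_one] at this

open Classical in
/-- The coefficient of the monomial with exponent `s` on `R / I`, or zero if this is not
well defined. -/
noncomputable def quotCoeff (I : Ideal (MvPolynomial (Fin 3) ℂ)) (s : Fin 3 →₀ ℕ) :
    (MvPolynomial (Fin 3) ℂ ⧸ I) →ₗ[ℂ] ℂ :=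
  if h : ∀ f ∈ I, coeff s f = 0 then
    ((I.restrictScalars ℂ).liftQ (lcoeff ℂ s) fun f hf => by simpa using h f hf) ∘ₗ
      (Submodule.Quotient.restrictScalarsEquiv ℂ I).symm.toLinearMap
  else 0

theorem quotCoeff_mk (hI : IsMonomialIdeal I) {s : Fin 3 →₀ ℕ} (hs : monomial s (1 : ℂ) ∉ I)
    (f : MvPolynomial (Fin 3) ℂ) : quotCoeff I s (Ideal.Quotient.mk I f) = coeff s f := by
  rw [quotCoeff, dif_pos fun f hf => hI.coeff_eq_zero hs hf]
  rfl

theorem eq_zero_of_quotCoeff (hI : IsMonomialIdeal I) {q : MvPolynomial (Fin 3) ℂ ⧸ I}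
    (h : ∀ s, monomial s (1 : ℂ) ∉ I → quotCoeff I s q = 0) : q = 0 := by
  obtain ⟨f, rfl⟩ := Ideal.Quotient.mk_surjective q
  rw [Ideal.Quotient.eq_zero_iff_mem]
  refine mem_of_forall_monomial_mem I fun d hd => ?_
  by_contra hdI
  have := h d hdI
  rw [quotCoeff_mk hI hdI] at this
  exact mem_support_iff.1 hd this

theorem monomial_mem_of_le {s t : Fin 3 →₀ ℕ} (hst : s ≤ t) (hs : monomial s (1 : ℂ) ∈ I) :
    monomial t (1 : ℂ) ∈ I := by
  have := I.mul_mem_left (monomial (t - s) (1 : ℂ)) hs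
  rwa [monomial_mul, one_mul, tsub_add_cancel_of_le hst] at this

theorem quotCoeff_X_smul_add (hI : IsMonomialIdeal I) {s : Fin 3 →₀ ℕ} (u : Fin 3)
    (hs : monomial (s + Finsupp.single u 1) (1 : ℂ) ∉ I) (q : MvPolynomial (Fin 3) ℂ ⧸ I) :
    quotCoeff I (s + Finsupp.single u 1) ((X u : MvPolynomial (Fin 3) ℂ) • q) =
      quotCoeff I s q := by
  obtain ⟨f, rfl⟩ := Ideal.Quotient.mk_surjective q
  have hs' : monomial s (1 : ℂ) ∉ I := fun h => hs (monomial_mem_of_le le_self_add h)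
  rw [← Ideal.Quotient.mk_eq_mk, ← Submodule.Quotient.mk_smul, Ideal.Quotient.mk_eq_mk,
    Ideal.Quotient.mk_eq_mk, quotCoeff_mk hI hs, quotCoeff_mk hI hs', add_comm, smul_eq_mul,
    coeff_X_mul]

theorem quotCoeff_X_smul_of_eq_zero (hI : IsMonomialIdeal I) {s : Fin 3 →₀ ℕ} (u : Fin 3)
    (hs : monomial s (1 : ℂ) ∉ I) (hu : s u = 0) (q : MvPolynomial (Fin 3) ℂ ⧸ I) :
    quotCoeff I s ((X u : MvPolynomial (Fin 3) ℂ) • q) = 0 := by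
  obtain ⟨f, rfl⟩ := Ideal.Quotient.mk_surjective q
  rw [← Ideal.Quotient.mk_eq_mk, ← Submodule.Quotient.mk_smul, Ideal.Quotient.mk_eq_mk,
    quotCoeff_mk hI hs, smul_eq_mul, coeff_X_mul', if_neg (by simpa using hu)]

/-- The colength of a monomial ideal is the number of its standard monomials. -/
theorem finrank_quotient_eq_card (hI : IsMonomialIdeal I) :
    Module.finrank ℂ (MvPolynomial (Fin 3) ℂ ⧸ I) =
      Nat.card {s : Fin 3 →₀ ℕ // monomial s (1 : ℂ) ∉ I} := by
  have key : ∀ s t : {s : Fin 3 →₀ ℕ // monomial s (1 : ℂ) ∉ I},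
      quotCoeff I s (Ideal.Quotient.mk I (monomial (t : Fin 3 →₀ ℕ) (1 : ℂ))) =
        if t = s then 1 else 0 := fun s t => by
    rw [quotCoeff_mk hI s.2, coeff_monomial]
    simp [Subtype.ext_iff]
  have hli : LinearIndependent ℂ fun t : {s : Fin 3 →₀ ℕ // monomial s (1 : ℂ) ∉ I} =>
      Ideal.Quotient.mk I (monomial (t : Fin 3 →₀ ℕ) (1 : ℂ)) := by
    rw [linearIndependent_iff']
    intro S g hg s hs
    have := congrArg (quotCoeff I s) hg
    simpa [map_sum, key, hs] using this
  refine Module.finrank_eq_nat_card_basis (Module.Basis.mk hli ?_)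
  rintro q -
  obtain ⟨f, rfl⟩ := Ideal.Quotient.mk_surjective q
  rw [← support_sum_monomial_coeff f, map_sum]
  refine Submodule.sum_mem _ fun d _ => ?_
  by_cases hd : monomial d (1 : ℂ) ∈ I
  · have h0 : monomial d (coeff d f) ∈ I := by
      have := I.mul_mem_left (C (coeff d f)) hd
      rwa [C_mul_monomial, mul_one] at this
    rw [Ideal.Quotient.eq_zero_iff_mem.2 h0]
    exact zero_mem _
  · have h1 : Ideal.Quotient.mk I (monomial d (coeff d f)) =
        coeff d f • Ideal.Quotient.mk I (monomial d (1 : ℂ)) := by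
      rw [← mul_one (coeff d f), ← smul_eq_mul, ← smul_monomial, smul_eq_mul, mul_one]
      rfl
    rw [h1]
    exact Submodule.smul_mem _ _ (Submodule.subset_span ⟨⟨d, hd⟩, rfl⟩)

open Classical in
/-- The coefficient of the monomial with exponent `s` in the image of the monomial with
exponent `m`, or zero if the latter is not in `I`. -/
noncomputable def homCoeff (I : Ideal (MvPolynomial (Fin 3) ℂ)) (m s : Fin 3 →₀ ℕ) :
    (↥I →ₗ[MvPolynomial (Fin 3) ℂ] (MvPolynomial (Fin 3) ℂ ⧸ I)) →ₗ[ℂ] ℂ :=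
  if h : monomial m (1 : ℂ) ∈ I then
    quotCoeff I s ∘ₗ
      { toFun := fun φ => φ ⟨monomial m 1, h⟩
        map_add' := fun _ _ => rfl
        map_smul' := fun _ _ => rfl }
  else 0

theorem homCoeff_apply {m : Fin 3 →₀ ℕ} (hm : monomial m (1 : ℂ) ∈ I) (s : Fin 3 →₀ ℕ)
    (φ : ↥I →ₗ[MvPolynomial (Fin 3) ℂ] (MvPolynomial (Fin 3) ℂ ⧸ I)) :
    homCoeff I m s φ = quotCoeff I s (φ ⟨monomial m 1, hm⟩) := by
  rw [homCoeff, dif_pos hm]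
  rfl

theorem hom_monomial_add {m : Fin 3 →₀ ℕ} (u : Fin 3) (hm : monomial m (1 : ℂ) ∈ I)
    (hm' : monomial (m + Finsupp.single u 1) (1 : ℂ) ∈ I)
    (φ : ↥I →ₗ[MvPolynomial (Fin 3) ℂ] (MvPolynomial (Fin 3) ℂ ⧸ I)) :
    φ ⟨monomial (m + Finsupp.single u 1) 1, hm'⟩ =
      (X u : MvPolynomial (Fin 3) ℂ) • φ ⟨monomial m 1, hm⟩ := by
  rw [← map_smul]
  congr 1
  ext1
  simp [X, monomial_mul, add_comm]

theorem homCoeff_add {m s : Fin 3 →₀ ℕ} (hI : IsMonomialIdeal I) (u : Fin 3)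
    (hm : monomial m (1 : ℂ) ∈ I) (hs : monomial (s + Finsupp.single u 1) (1 : ℂ) ∉ I)
    (φ : ↥I →ₗ[MvPolynomial (Fin 3) ℂ] (MvPolynomial (Fin 3) ℂ ⧸ I)) :
    homCoeff I (m + Finsupp.single u 1) (s + Finsupp.single u 1) φ = homCoeff I m s φ := by
  have hm' : monomial (m + Finsupp.single u 1) (1 : ℂ) ∈ I := monomial_mem_of_le le_self_add hm
  rw [homCoeff_apply hm', homCoeff_apply hm, hom_monomial_add u hm, quotCoeff_X_smul_add hI u hs]

theorem homCoeff_add_of_eq_zero {m s : Fin 3 →₀ ℕ} (hI : IsMonomialIdeal I) (u : Fin 3)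
    (hm : monomial m (1 : ℂ) ∈ I) (hs : monomial s (1 : ℂ) ∉ I) (hu : s u = 0)
    (φ : ↥I →ₗ[MvPolynomial (Fin 3) ℂ] (MvPolynomial (Fin 3) ℂ ⧸ I)) :
    homCoeff I (m + Finsupp.single u 1) s φ = 0 := by
  have hm' : monomial (m + Finsupp.single u 1) (1 : ℂ) ∈ I := monomial_mem_of_le le_self_add hm
  rw [homCoeff_apply hm', hom_monomial_add u hm, quotCoeff_X_smul_of_eq_zero hI u hs hu]

theorem hom_eq_zero_of_monomial
    {φ : ↥I →ₗ[MvPolynomial (Fin 3) ℂ] (MvPolynomial (Fin 3) ℂ ⧸ I)} (hI : IsMonomialIdeal I)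
    (h : ∀ m, ∀ hm : monomial m (1 : ℂ) ∈ I, φ ⟨monomial m 1, hm⟩ = 0) : φ = 0 := by
  have hker : ∀ f ∈ I, f ∈ Submodule.map I.subtype (LinearMap.ker φ) := fun f hf =>
    mem_of_forall_monomial_mem _ fun d hd => ⟨⟨_, hI f hf d hd⟩, h d _, rfl⟩
  ext1 f
  obtain ⟨g, hg, hgf⟩ := hker f f.2
  rw [← Subtype.ext hgf]
  exact hg

/-- A linear map on all polynomials that commutes with multiplication by variables on the monomials
of a monomial ideal restricts to a module homomorphism on the ideal. -/
theorem exists_hom_of_forall_monomial (hI : IsMonomialIdeal I)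
    (F : MvPolynomial (Fin 3) ℂ →ₗ[ℂ] (MvPolynomial (Fin 3) ℂ ⧸ I))
    (h : ∀ m, monomial m (1 : ℂ) ∈ I → ∀ u : Fin 3,
      F (monomial (m + Finsupp.single u 1) 1) =
        (X u : MvPolynomial (Fin 3) ℂ) • F (monomial m 1)) :
    ∃ φ : ↥I →ₗ[MvPolynomial (Fin 3) ℂ] (MvPolynomial (Fin 3) ℂ ⧸ I), ∀ f : I, φ f = F f := by
  have hX : ∀ u : Fin 3, ∀ f ∈ I, F (X u * f) = (X u : MvPolynomial (Fin 3) ℂ) • F f := by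
    intro u f hf
    conv_lhs => rw [← support_sum_monomial_coeff f]
    conv_rhs => rw [← support_sum_monomial_coeff f]
    rw [Finset.mul_sum, map_sum, map_sum, Finset.smul_sum]
    refine Finset.sum_congr rfl fun d hd => ?_
    have e : monomial d (coeff d f) = coeff d f • monomial d (1 : ℂ) := by
      rw [smul_monomial, smul_eq_mul, mul_one]
    rw [e, mul_smul_comm, map_smul, map_smul, smul_comm, ← h d (hI f hf d hd) u]
    congr 2
    simp [X, monomial_mul, add_comm]
  have hp : ∀ p f : MvPolynomial (Fin 3) ℂ, f ∈ I → F (p * f) = p • F f := by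
    intro p
    induction p using MvPolynomial.induction_on with
    | C a =>
      intro f _
      rw [← smul_eq_C_mul, map_smul, ← algebraMap_eq, algebraMap_smul]
    | add p q hp hq =>
      intro f hf
      rw [add_mul, map_add, hp f hf, hq f hf, add_smul]
    | mul_X p u hp =>
      intro f hf
      rw [mul_assoc, hp _ (I.mul_mem_left _ hf), hX u f hf, smul_smul]
  exact ⟨{ toFun := fun f => F f
           map_add' := fun f g => by simp
           map_smul' := fun p f => by simpa using hp p f f.2 }, fun f => rfl⟩

end MonomialIdeal

namespace Staircase

/-- Exponents of monomials in three variables. -/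
abbrev Pt := ℕ × ℕ × ℕ

/-- Increase the `u`-th exponent by one. -/
def inc (u : Fin 3) (p : Pt) : Pt :=
  match u with
  | 0 => (p.1 + 1, p.2.1, p.2.2)
  | 1 => (p.1, p.2.1 + 1, p.2.2)
  | 2 => (p.1, p.2.1, p.2.2 + 1)

/-- Decrease the `u`-th exponent by one. -/
def dec (u : Fin 3) (p : Pt) : Pt :=
  match u with
  | 0 => (p.1 - 1, p.2.1, p.2.2)
  | 1 => (p.1, p.2.1 - 1, p.2.2)
  | 2 => (p.1, p.2.1, p.2.2 - 1)

/-- The `u`-th exponent. -/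
def get (u : Fin 3) (p : Pt) : ℕ :=
  match u with
  | 0 => p.1
  | 1 => p.2.1
  | 2 => p.2.2

/-- Height of the column over `(i, j)` in the staircase whose `i`-th layer has the column heights
listed in the `i`-th row of `L`. -/
def ht (L : List (List ℕ)) (i j : ℕ) : ℕ := (L.getD i []).getD j 0

/-- Is this the exponent of a standard monomial? -/
def isStd (L : List (List ℕ)) (p : Pt) : Bool := Nat.blt p.2.2 (ht L p.1 p.2.1)

/-- First side length of the bounding box of the staircase. -/
def xDim (L : List (List ℕ)) : ℕ := L.length

/-- Second side length of the bounding box of the staircase. -/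
def yDim (L : List (List ℕ)) : ℕ := (L.getD 0 []).length

/-- Third side length of the bounding box of the staircase. -/
def zDim (L : List (List ℕ)) : ℕ := ht L 0 0

/-- The staircase is contained in its bounding box. -/
def boxed (L : List (List ℕ)) : Bool :=
  L.all fun r => Nat.ble r.length (yDim L) && r.all fun k => Nat.ble k (zDim L)

/-- Exponents of the standard monomials. -/
def cells (L : List (List ℕ)) : List Pt :=
  (List.range (xDim L)).flatMap fun i => (List.range (yDim L)).flatMap fun j =>
    (List.range (ht L i j)).map fun k => (i, j, k)

/-- Exponents in the closed bounding box of monomials in the ideal. -/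
def outs (L : List (List ℕ)) : List Pt :=
  (List.range (xDim L + 1)).flatMap fun i => (List.range (yDim L + 1)).flatMap fun j =>
    (List.range (zDim L + 1 - ht L i j)).map fun k => (i, j, ht L i j + k)

/-- Exponents of the minimal monomial generators of the ideal. -/
def gens (L : List (List ℕ)) : List Pt :=
  (List.range (xDim L + 1)).flatMap fun i => (List.range (yDim L + 1)).filterMap fun j =>
    bif (Nat.beq i 0 || Nat.blt (ht L i j) (ht L (i - 1) j)) &&
      (Nat.beq j 0 || Nat.blt (ht L i j) (ht L i (j - 1)))
    then some (i, j, ht L i j) else none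

/-- Mixed radix encoding of an exponent. -/
def code (b c : ℕ) (p : Pt) : ℕ :=
  Nat.add (Nat.mul (Nat.add (Nat.mul p.1 (Nat.add b 2)) p.2.1) (Nat.add c 2)) p.2.2

/-- A bound for the codes of exponents in the bounding box. -/
def codeBound (a b c : ℕ) : ℕ := (a + 2) * ((b + 2) * (c + 2))

/-- Encoding of a pair of exponents. -/
def pos (K b c : ℕ) (m s : Pt) : ℕ := Nat.add (code b c m) (Nat.mul K (code b c s))

/-- The natural number whose binary digits equal to one are at the given positions. -/
def mask (l : List ℕ) : ℕ := l.foldr (fun p acc => Nat.lor (Nat.shiftLeft 1 p) acc) 0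

/-- Evaluates its first argument before passing it on. -/
def strict {α : Type} (n : ℕ) (k : ℕ → α) : α :=
  match n with
  | 0 => k 0
  | n + 1 => k (n + 1)

/-- Add to `F` the positions of `N` that differ by `d` from a position in `F`. -/
def spread (N d F : ℕ) : ℕ :=
  Nat.lor F (Nat.land (Nat.lor (Nat.shiftLeft F d) (Nat.shiftRight F d)) N)

/-- Iterate `spread` in the three directions until the set stabilises. -/
def flood (N dx dy dz : ℕ) : ℕ → ℕ → ℕ
  | 0, F => F
  | n + 1, F =>
    strict (spread N dx (spread N dy (spread N dz F))) fun F' =>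
      bif Nat.beq F' F then F else flood N dx dy dz n F'

/-- Count positions of pairs `(m, s)` with `m` in `ms` that are not in `F`, closing `F` up under
`fl` after each `s` in the given list. -/
def countReps (fl : ℕ → ℕ) (ps : Pt → Pt → ℕ) (ms : List Pt) : List Pt → ℕ → ℕ
  | [], _ => 0
  | s :: l, F =>
    match ms.filter fun m => !F.testBit (ps m s) with
    | [] => countReps fl ps ms l F
    | m :: B =>
      strict (fl (Nat.lor F (mask ((m :: B).map fun m => ps m s)))) fun F' =>
        (m :: B).length + countReps fl ps ms l F'

/-- The positions `r + d + K * code s` with `s` in the given list and `r` a position in `R`. -/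
def pairMask (R d K b c : ℕ) (l : List Pt) : ℕ :=
  l.foldr (fun s acc => Nat.lor (Nat.shiftLeft R (Nat.add d (Nat.mul K (code b c s)))) acc) 0

/-- The positions of pairs `(m, s)` such that division by the `u`-th variable is possible in the
ideal for `m` but not possible for `s`. -/
def groundMask (L : List (List ℕ)) (R K b c : ℕ) (u : Fin 3) : ℕ :=
  pairMask R (code b c (inc u (0, 0, 0))) K b c ((cells L).filter fun s => Nat.beq (get u s) 0)

/-- The difference of the positions of `(inc u m, inc u s)` and `(m, s)`. -/
def posDiff (K b c : ℕ) (u : Fin 3) : ℕ := pos K b c (inc u (0, 0, 0)) (inc u (0, 0, 0))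

/-- An upper bound for the dimension of the tangent space. -/
def upperBound (L : List (List ℕ)) : ℕ :=
  strict (yDim L) fun b =>
  strict (zDim L) fun c =>
  strict (codeBound (xDim L) b c) fun K =>
  strict (mask ((outs L).map (code b c))) fun R =>
  strict (pairMask R 0 K b c (cells L)) fun N =>
  strict (posDiff K b c 0) fun dx =>
  strict (posDiff K b c 1) fun dy =>
  strict (posDiff K b c 2) fun dz =>
  strict (flood N dx dy dz 100 (Nat.land (Nat.lor (groundMask L R K b c 0)
    (Nat.lor (groundMask L R K b c 1) (groundMask L R K b c 2))) N)) fun F =>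
  countReps (flood N dx dy dz 100) (pos K b c) (gens L) (cells L).reverse F

section Combinatorics

variable {L : List (List ℕ)}

theorem ht_eq_zero_of_xDim_le {i : ℕ} (h : xDim L ≤ i) (j : ℕ) : ht L i j = 0 := by
  rw [ht, List.getD_eq_default _ _ h, List.getD_nil]

theorem boxed.row {r : List ℕ} (h : boxed L = true) (hr : r ∈ L) :
    r.length ≤ yDim L ∧ ∀ k ∈ r, k ≤ zDim L := by
  have := List.all_eq_true.1 h r hr
  simpa using this

theorem ht_eq_zero_of_yDim_le (h : boxed L = true) (i : ℕ) {j : ℕ} (hj : yDim L ≤ j) :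
    ht L i j = 0 := by
  rcases lt_or_ge i L.length with hi | hi
  · have hr := (boxed.row h (List.getElem_mem hi)).1.trans hj
    rw [ht, List.getD_eq_getElem _ _ hi, List.getD_eq_default _ _ hr]
  · exact ht_eq_zero_of_xDim_le hi j

theorem ht_le_zDim (h : boxed L = true) (i j : ℕ) : ht L i j ≤ zDim L := by
  rcases lt_or_ge i L.length with hi | hi
  · rw [ht, List.getD_eq_getElem _ _ hi]
    rcases lt_or_ge j L[i].length with hj | hj
    · rw [List.getD_eq_getElem _ _ hj]
      exact (boxed.row h (List.getElem_mem hi)).2 _ (List.getElem_mem hj)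
    · rw [List.getD_eq_default _ _ hj]
      exact Nat.zero_le _
  · rw [ht_eq_zero_of_xDim_le hi j]
    exact Nat.zero_le _

theorem mem_cells (h : boxed L = true) {p : Pt} : p ∈ cells L ↔ p.2.2 < ht L p.1 p.2.1 := by
  obtain ⟨i, j, k⟩ := p
  simp only [cells, List.mem_flatMap, List.mem_map, List.mem_range, Prod.mk.injEq]
  constructor
  · rintro ⟨_, _, _, _, _, hk, rfl, rfl, rfl⟩
    exact hk
  · intro hk
    refine ⟨i, ?_, j, ?_, k, hk, rfl, rfl, rfl⟩
    · by_contra hi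
      rw [ht_eq_zero_of_xDim_le (not_lt.1 hi)] at hk
      omega
    · by_contra hj
      rw [ht_eq_zero_of_yDim_le h _ (not_lt.1 hj)] at hk
      omega

theorem mem_outs {p : Pt} : p ∈ outs L ↔
    p.1 ≤ xDim L ∧ p.2.1 ≤ yDim L ∧ p.2.2 ≤ zDim L ∧ ht L p.1 p.2.1 ≤ p.2.2 := by
  obtain ⟨i, j, k⟩ := p
  simp only [outs, List.mem_flatMap, List.mem_map, List.mem_range, Prod.mk.injEq]
  constructor
  · rintro ⟨_, _, _, _, _, _, rfl, rfl, rfl⟩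
    omega
  · rintro ⟨hi, hj, hk, hk'⟩
    exact ⟨i, by omega, j, by omega, k - ht L i j, by omega, rfl, rfl, by omega⟩

theorem mem_gens {p : Pt} : p ∈ gens L ↔ p.1 ≤ xDim L ∧ p.2.1 ≤ yDim L ∧
    (p.1 = 0 ∨ ht L p.1 p.2.1 < ht L (p.1 - 1) p.2.1) ∧
    (p.2.1 = 0 ∨ ht L p.1 p.2.1 < ht L p.1 (p.2.1 - 1)) ∧ p.2.2 = ht L p.1 p.2.1 := by
  obtain ⟨i, j, k⟩ := p
  simp only [gens, List.mem_flatMap, List.mem_filterMap, List.mem_range, Bool.cond_eq_ite,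
    Option.ite_none_right_eq_some, Option.some.injEq, Prod.mk.injEq, Bool.and_eq_true,
    Bool.or_eq_true, Nat.beq_eq, Nat.blt_eq]
  constructor
  · rintro ⟨_, _, _, _, ⟨_, _⟩, rfl, rfl, rfl⟩
    refine ⟨?_, ?_, ?_, ?_, ?_⟩ <;> first | assumption | omega
  · rintro ⟨_, _, _, _, rfl⟩
    exact ⟨i, by omega, j, by omega, ⟨by assumption, by assumption⟩, rfl, rfl, rfl⟩

theorem mem_outs_of_mem_gens (h : boxed L = true) {p : Pt} (hp : p ∈ gens L) : p ∈ outs L := by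
  obtain ⟨hx, hy, -, -, hz⟩ := mem_gens.1 hp
  exact mem_outs.2 ⟨hx, hy, hz ▸ ht_le_zDim h _ _, hz.ge⟩

theorem exists_dec_of_notMem_gens (h : boxed L = true) {p : Pt} (hp : ht L p.1 p.2.1 ≤ p.2.2)
    (hg : p ∉ gens L) : ∃ u q, p = inc u q ∧ ht L q.1 q.2.1 ≤ q.2.2 := by
  obtain ⟨i, j, k⟩ := p
  by_contra! H
  have hx := fun hi : i ≠ 0 => H 0 (i - 1, j, k) (by simp [inc]; omega)
  have hy := fun hj : j ≠ 0 => H 1 (i, j - 1, k) (by simp [inc]; omega)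
  have hz := fun hk : k ≠ 0 => H 2 (i, j, k - 1) (by simp [inc]; omega)
  simp only at hp hx hy hz
  refine hg (mem_gens.2 ⟨?_, ?_, ?_, ?_, ?_⟩) <;> simp only
  · by_contra hi
    have := hx (by omega)
    rw [ht_eq_zero_of_xDim_le (by omega)] at this
    omega
  · by_contra hj
    have := hy (by omega)
    rw [ht_eq_zero_of_yDim_le h _ (by omega)] at this
    omega
  · by_cases hi : i = 0
    · exact .inl hi
    · exact .inr (by have := hx hi; omega)
  · by_cases hj : j = 0
    · exact .inl hj
    · exact .inr (by have := hy hj; omega)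
  · by_cases hk : k = 0
    · omega
    · have := hz hk
      omega

end Combinatorics

section Encoding

theorem add_mul_inj {r x x' y y' : ℕ} (hx : x < r) (hx' : x' < r) (h : x + r * y = x' + r * y') :
    x = x' ∧ y = y' := by
  have h1 := congrArg (· % r) h
  have h2 := congrArg (· / r) h
  simp only [Nat.add_mul_mod_self_left, Nat.mod_eq_of_lt hx, Nat.mod_eq_of_lt hx'] at h1
  simp only [Nat.add_mul_div_left _ _ (by omega : 0 < r), Nat.div_eq_of_lt hx,
    Nat.div_eq_of_lt hx', zero_add] at h2
  exact ⟨h1, h2⟩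

/-- The bounding box of side lengths `a`, `b` and `c`, enlarged by one layer. -/
def inBox (a b c : ℕ) (p : Pt) : Prop := p.1 < a + 2 ∧ p.2.1 < b + 2 ∧ p.2.2 < c + 2

theorem code_eq (b c : ℕ) (p : Pt) :
    code b c p = p.2.2 + (c + 2) * (p.2.1 + (b + 2) * p.1) := by
  change (p.1 * (b + 2) + p.2.1) * (c + 2) + p.2.2 = _
  ring

theorem code_lt {a b c : ℕ} {p : Pt} (hp : inBox a b c p) : code b c p < codeBound a b c := by
  obtain ⟨h1, h2, h3⟩ := hp
  rw [code_eq, codeBound]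
  have h4 : p.2.1 + (b + 2) * p.1 + 1 ≤ (b + 2) * (a + 2) := by nlinarith
  nlinarith

theorem code_inj {a b c : ℕ} {p q : Pt} (hp : inBox a b c p) (hq : inBox a b c q)
    (h : code b c p = code b c q) : p = q := by
  rw [code_eq, code_eq] at h
  obtain ⟨h3, h⟩ := add_mul_inj hp.2.2 hq.2.2 h
  obtain ⟨h2, h1⟩ := add_mul_inj hp.2.1 hq.2.1 h
  exact Prod.ext h1 (Prod.ext h2 h3)

theorem pos_eq (K b c : ℕ) (m s : Pt) : pos K b c m s = code b c m + K * code b c s := rfl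

theorem pos_inj {a b c : ℕ} {m s m' s' : Pt} (hm : inBox a b c m) (hm' : inBox a b c m')
    (hs : inBox a b c s) (hs' : inBox a b c s')
    (h : pos (codeBound a b c) b c m s = pos (codeBound a b c) b c m' s') : m = m' ∧ s = s' := by
  rw [pos_eq, pos_eq] at h
  obtain ⟨h1, h2⟩ := add_mul_inj (code_lt hm) (code_lt hm') h
  exact ⟨code_inj hm hm' h1, code_inj hs hs' h2⟩

theorem code_inc (b c : ℕ) (u : Fin 3) (p : Pt) :
    code b c (inc u p) = code b c p + code b c (inc u (0, 0, 0)) := by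
  simp only [code_eq]
  fin_cases u <;> simp [inc] <;> ring

theorem pos_inc (K b c : ℕ) (u : Fin 3) (m s : Pt) :
    pos K b c (inc u m) (inc u s) = pos K b c m s + posDiff K b c u := by
  rw [posDiff, pos_eq, pos_eq, pos_eq, code_inc b c u m, code_inc b c u s]
  ring

end Encoding

section Bits

theorem testBit_lor (x y p : ℕ) :
    (Nat.lor x y).testBit p = true ↔ x.testBit p = true ∨ y.testBit p = true := by
  change (x ||| y).testBit p = true ↔ _
  rw [Nat.testBit_or, Bool.or_eq_true]

theorem testBit_land (x y p : ℕ) :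
    (Nat.land x y).testBit p = true ↔ x.testBit p = true ∧ y.testBit p = true := by
  change (x &&& y).testBit p = true ↔ _
  rw [Nat.testBit_and, Bool.and_eq_true]

theorem testBit_shiftLeft (x d p : ℕ) :
    (Nat.shiftLeft x d).testBit p = true ↔ ∃ q, x.testBit q = true ∧ p = q + d := by
  change (x <<< d).testBit p = true ↔ _
  rw [Nat.testBit_shiftLeft, Bool.and_eq_true, decide_eq_true_eq]
  constructor
  · exact fun ⟨h, h'⟩ => ⟨_, h', (Nat.sub_add_cancel h).symm⟩
  · rintro ⟨q, h, rfl⟩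
    simpa using h

theorem testBit_shiftRight (x d p : ℕ) :
    (Nat.shiftRight x d).testBit p = true ↔ x.testBit (p + d) = true := by
  change (x >>> d).testBit p = true ↔ _
  rw [Nat.testBit_shiftRight, add_comm]

theorem testBit_mask (l : List ℕ) (p : ℕ) : (mask l).testBit p = true ↔ p ∈ l := by
  induction l with
  | nil => simp [mask]
  | cons q l ih =>
    change (Nat.lor (Nat.shiftLeft 1 q) (mask l)).testBit p = true ↔ _
    rw [testBit_lor, ih, testBit_shiftLeft, List.mem_cons]
    simp [Nat.testBit_one_eq_true_iff_self_eq_zero]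

theorem testBit_pairMask (R d K b c : ℕ) (l : List Pt) (p : ℕ) :
    (pairMask R d K b c l).testBit p = true ↔
      ∃ s ∈ l, ∃ r, R.testBit r = true ∧ p = r + d + K * code b c s := by
  induction l with
  | nil => simp [pairMask]
  | cons s l ih =>
    change (Nat.lor (Nat.shiftLeft R (d + K * code b c s)) (pairMask R d K b c l)).testBit p = true
      ↔ _
    rw [testBit_lor, ih, testBit_shiftLeft]
    simp [add_assoc]

theorem strict_eq {α : Type} (n : ℕ) (k : ℕ → α) : strict n k = k n := by
  cases n <;> rfl

/-- All binary digits of `F` equal to one are at positions in `W`. -/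
def Sub (F : ℕ) (W : Set ℕ) : Prop := ∀ p, F.testBit p = true → p ∈ W

/-- `W` is closed under moving by `d` in either direction inside `N`. -/
def ClosedUnder (N : ℕ) (W : Set ℕ) (d : ℕ) : Prop :=
  (∀ p ∈ W, N.testBit (p + d) = true → p + d ∈ W) ∧
    ∀ p, N.testBit p = true → p + d ∈ W → p ∈ W

variable {N d dx dy dz : ℕ} {W : Set ℕ}

theorem Sub.spread (hW : ClosedUnder N W d) {F : ℕ} (hF : Sub F W) : Sub (spread N d F) W := by
  intro p hp
  rw [Staircase.spread, testBit_lor, testBit_land, testBit_lor, testBit_shiftLeft,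
    testBit_shiftRight] at hp
  rcases hp with hp | ⟨⟨q, hq, rfl⟩ | hq, hN⟩
  · exact hF p hp
  · exact hW.1 q (hF q hq) hN
  · exact hW.2 p hN (hF _ hq)

theorem Sub.flood (hx : ClosedUnder N W dx) (hy : ClosedUnder N W dy) (hz : ClosedUnder N W dz)
    (n : ℕ) {F : ℕ} (hF : Sub F W) : Sub (flood N dx dy dz n F) W := by
  induction n generalizing F with
  | zero => exact hF
  | succ n ih =>
    rw [Staircase.flood, strict_eq, Bool.cond_eq_ite]
    split
    · exact hF
    · exact ih (((hF.spread hz).spread hy).spread hx)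

theorem exists_reps (fl : ℕ → ℕ) (ps : Pt → Pt → ℕ) (ms l : List Pt) (F : ℕ) :
    ∃ B : List (Pt × Pt), B.length = countReps fl ps ms l F ∧ (∀ n ∈ B, n.1 ∈ ms ∧ n.2 ∈ l) ∧
      ∀ W : Set ℕ, (∀ F, Sub F W → Sub (fl F) W) → Sub F W → (∀ n ∈ B, ps n.1 n.2 ∈ W) →
        ∀ s ∈ l, ∀ m ∈ ms, ps m s ∈ W := by
  induction l generalizing F with
  | nil => exact ⟨[], rfl, by simp, by simp⟩
  | cons s l ih =>
    rw [countReps]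
    have hfilter : ∀ m, m ∈ ms.filter (fun m => !F.testBit (ps m s)) ↔
        m ∈ ms ∧ F.testBit (ps m s) = false := fun m => by simp [List.mem_filter]
    split
    · rename_i hB
      obtain ⟨B, hlen, hmem, h⟩ := ih F
      refine ⟨B, hlen, fun n hn => ⟨(hmem n hn).1, List.mem_cons_of_mem _ (hmem n hn).2⟩,
        fun W hfl hF hBW => List.forall_mem_cons.2 ⟨fun m hm => ?_, h W hfl hF hBW⟩⟩
      by_contra hmW
      have := (hfilter m).2 ⟨hm, by
        by_contra hb
        exact hmW (hF _ (by simpa using hb))⟩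
      rw [hB] at this
      simp at this
    · rename_i m' B' hB
      rw [strict_eq]
      obtain ⟨B, hlen, hmem, h⟩ := ih (fl (Nat.lor F (mask ((m' :: B').map fun m => ps m s))))
      refine ⟨(m' :: B').map (fun m => (m, s)) ++ B, by
        rw [List.length_append, List.length_map, hlen], fun n hn => ?_, fun W hfl hF hBW => ?_⟩
      · rcases List.mem_append.1 hn with hn | hn
        · obtain ⟨m, hm, rfl⟩ := List.mem_map.1 hn
          exact ⟨((hfilter m).1 (hB ▸ hm)).1, List.mem_cons_self⟩
        · exact ⟨(hmem n hn).1, List.mem_cons_of_mem _ (hmem n hn).2⟩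
      · rw [List.forall_mem_append, List.forall_mem_map] at hBW
        refine List.forall_mem_cons.2 ⟨fun m hm => ?_, h W hfl (hfl _ fun p hp => ?_) hBW.2⟩
        · by_cases hb : F.testBit (ps m s) = true
          · exact hF _ hb
          · exact hBW.1 m (hB ▸ (hfilter m).2 ⟨hm, by simpa using hb⟩)
        · rw [testBit_lor, testBit_mask] at hp
          rcases hp with hp | hp
          · exact hF p hp
          · obtain ⟨m, hm, rfl⟩ := List.mem_map.1 hp
            exact hBW.1 m hm

end Bits

section Geometry

/-- The exponent as a finitely supported function. -/
noncomputable def expo (p : Pt) : Fin 3 →₀ ℕ :=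
  Finsupp.equivFunOnFinite.symm ![p.1, p.2.1, p.2.2]

theorem expo_apply (p : Pt) (u : Fin 3) : expo p u = get u p := by
  fin_cases u <;> rfl

theorem expo_inc (u : Fin 3) (p : Pt) : expo (inc u p) = expo p + Finsupp.single u 1 := by
  ext v
  rw [Finsupp.add_apply, expo_apply, expo_apply]
  fin_cases u <;> fin_cases v <;> simp [inc, get]

theorem expo_mk (d : Fin 3 →₀ ℕ) : expo (d 0, d 1, d 2) = d := by
  ext v
  rw [expo_apply]
  fin_cases v <;> rfl

theorem expo_injective : Function.Injective expo := by
  intro p q h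
  have := fun u => expo_apply p u ▸ expo_apply q u ▸ DFunLike.congr_fun h u
  exact Prod.ext (this 0) (Prod.ext (this 1) (this 2))

/-- The ideal `I` is a monomial ideal whose standard monomials are given by the column heights
`L`. -/
structure Fits (I : Ideal (MvPolynomial (Fin 3) ℂ)) (L : List (List ℕ)) : Prop where
  isMonomialIdeal : IsMonomialIdeal I
  mem_iff : ∀ p : Pt, monomial (expo p) (1 : ℂ) ∈ I ↔ ht L p.1 p.2.1 ≤ p.2.2

variable {I : Ideal (MvPolynomial (Fin 3) ℂ)} {L : List (List ℕ)}

theorem Fits.notMem_iff (hF : Fits I L) (hL : boxed L = true) (p : Pt) :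
    monomial (expo p) (1 : ℂ) ∉ I ↔ p ∈ cells L := by
  rw [hF.mem_iff, mem_cells hL, not_le]

theorem inBox_of_mem_outs {p : Pt} (hp : p ∈ outs L) : inBox (xDim L) (yDim L) (zDim L) p := by
  obtain ⟨h1, h2, h3, -⟩ := mem_outs.1 hp
  refine ⟨?_, ?_, ?_⟩ <;> omega

theorem bounds_of_mem_cells (hL : boxed L = true) {p : Pt} (hp : p ∈ cells L) :
    p.1 < xDim L ∧ p.2.1 < yDim L ∧ p.2.2 < zDim L := by
  rw [mem_cells hL] at hp
  refine ⟨?_, ?_, hp.trans_le (ht_le_zDim hL _ _)⟩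
  · by_contra h
    rw [ht_eq_zero_of_xDim_le (not_lt.1 h)] at hp
    omega
  · by_contra h
    rw [ht_eq_zero_of_yDim_le hL _ (not_lt.1 h)] at hp
    omega

theorem inBox_of_mem_cells (hL : boxed L = true) {p : Pt} (hp : p ∈ cells L) :
    inBox (xDim L) (yDim L) (zDim L) p := by
  obtain ⟨h1, h2, h3⟩ := bounds_of_mem_cells hL hp
  refine ⟨?_, ?_, ?_⟩ <;> omega

theorem inBox_inc_of_mem_outs {p : Pt} (hp : p ∈ outs L) (u : Fin 3) :
    inBox (xDim L) (yDim L) (zDim L) (inc u p) := by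
  obtain ⟨h1, h2, h3, -⟩ := mem_outs.1 hp
  fin_cases u <;> refine ⟨?_, ?_, ?_⟩ <;> simp [inc] <;> omega

theorem inBox_inc_of_mem_cells (hL : boxed L = true) {p : Pt} (hp : p ∈ cells L) (u : Fin 3) :
    inBox (xDim L) (yDim L) (zDim L) (inc u p) := by
  obtain ⟨h1, h2, h3⟩ := bounds_of_mem_cells hL hp
  fin_cases u <;> refine ⟨?_, ?_, ?_⟩ <;> simp [inc] <;> omega

/-- The position of a pair of exponents in the bounding box of `L`. -/
def nodePos (L : List (List ℕ)) (m s : Pt) : ℕ :=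
  pos (codeBound (xDim L) (yDim L) (zDim L)) (yDim L) (zDim L) m s

/-- The set of the positions of pairs `(m, s)` for which the coefficient of the monomial with
exponent `s` in the image of the monomial with exponent `m` under `φ` vanishes. -/
def vanishing (L : List (List ℕ))
    (φ : ↥I →ₗ[MvPolynomial (Fin 3) ℂ] (MvPolynomial (Fin 3) ℂ ⧸ I)) : Set ℕ :=
  {p | ∃ m ∈ outs L, ∃ s ∈ cells L, p = nodePos L m s ∧ homCoeff I (expo m) (expo s) φ = 0}

theorem testBit_pairMask_outs (d : ℕ) (l : List Pt) (p : ℕ) :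
    (pairMask (mask ((outs L).map (code (yDim L) (zDim L)))) d
      (codeBound (xDim L) (yDim L) (zDim L)) (yDim L) (zDim L) l).testBit p = true ↔
      ∃ m ∈ outs L, ∃ s ∈ l, p = nodePos L m s + d := by
  rw [testBit_pairMask]
  simp only [testBit_mask, List.mem_map]
  constructor
  · rintro ⟨s, hs, _, ⟨m, hm, rfl⟩, rfl⟩
    exact ⟨m, hm, s, hs, by rw [nodePos, pos_eq]; ring⟩
  · rintro ⟨m, hm, s, hs, rfl⟩
    exact ⟨s, hs, _, ⟨m, hm, rfl⟩, by rw [nodePos, pos_eq]; ring⟩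

variable {φ : ↥I →ₗ[MvPolynomial (Fin 3) ℂ] (MvPolynomial (Fin 3) ℂ ⧸ I)}

theorem homCoeff_eq_zero_of_nodePos_mem (hL : boxed L = true) {m s : Pt}
    (hm : m ∈ outs L) (hs : s ∈ cells L) (h : nodePos L m s ∈ vanishing L φ) :
    homCoeff I (expo m) (expo s) φ = 0 := by
  obtain ⟨m', hm', s', hs', hp, h0⟩ := h
  obtain ⟨rfl, rfl⟩ := pos_inj (inBox_of_mem_outs hm) (inBox_of_mem_outs hm')
    (inBox_of_mem_cells hL hs) (inBox_of_mem_cells hL hs') hp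
  exact h0

theorem closedUnder_vanishing (hF : Fits I L) (hL : boxed L = true) (u : Fin 3) :
    ClosedUnder (pairMask (mask ((outs L).map (code (yDim L) (zDim L)))) 0
      (codeBound (xDim L) (yDim L) (zDim L)) (yDim L) (zDim L) (cells L)) (vanishing L φ)
      (posDiff (codeBound (xDim L) (yDim L) (zDim L)) (yDim L) (zDim L) u) := by
  have key : ∀ m ∈ outs L, ∀ s ∈ cells L, ∀ m' ∈ outs L, ∀ s' ∈ cells L,
      nodePos L m s + posDiff (codeBound (xDim L) (yDim L) (zDim L)) (yDim L) (zDim L) u =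
        nodePos L m' s' →
      homCoeff I (expo m) (expo s) φ = homCoeff I (expo m') (expo s') φ := by
    intro m hm s hs m' hm' s' hs' h
    rw [nodePos, ← pos_inc] at h
    obtain ⟨rfl, rfl⟩ := pos_inj (inBox_inc_of_mem_outs hm u) (inBox_of_mem_outs hm')
      (inBox_inc_of_mem_cells hL hs u) (inBox_of_mem_cells hL hs') h
    rw [← hF.notMem_iff hL, expo_inc] at hs'
    rw [expo_inc, expo_inc,
      homCoeff_add hF.isMonomialIdeal u ((hF.mem_iff m).2 (mem_outs.1 hm).2.2.2) hs']
  constructor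
  · rintro _ ⟨m, hm, s, hs, rfl, h0⟩ hN
    obtain ⟨m', hm', s', hs', h⟩ := (testBit_pairMask_outs _ _ _).1 hN
    exact ⟨m', hm', s', hs', h, (key m hm s hs m' hm' s' hs' h).symm.trans h0⟩
  · rintro p hN ⟨m', hm', s', hs', h, h0⟩
    obtain ⟨m, hm, s, hs, rfl⟩ := (testBit_pairMask_outs _ _ _).1 hN
    exact ⟨m, hm, s, hs, rfl, (key m hm s hs m' hm' s' hs' h).trans h0⟩

theorem groundMask_subset_vanishing (hF : Fits I L) (hL : boxed L = true) (u : Fin 3) {p : ℕ}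
    (hp : (groundMask L (mask ((outs L).map (code (yDim L) (zDim L))))
      (codeBound (xDim L) (yDim L) (zDim L)) (yDim L) (zDim L) u).testBit p = true)
    (hN : (pairMask (mask ((outs L).map (code (yDim L) (zDim L)))) 0
      (codeBound (xDim L) (yDim L) (zDim L)) (yDim L) (zDim L) (cells L)).testBit p = true) :
    p ∈ vanishing L φ := by
  obtain ⟨m, hm, s, hs, rfl⟩ := (testBit_pairMask_outs _ _ _).1 hp
  obtain ⟨m', hm', s', hs', h⟩ := (testBit_pairMask_outs _ _ _).1 hN
  obtain ⟨hs, hu⟩ := List.mem_filter.1 hs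
  rw [nodePos, pos_eq, add_right_comm, ← code_inc, ← pos_eq] at h
  obtain ⟨rfl, rfl⟩ := pos_inj (inBox_inc_of_mem_outs hm u) (inBox_of_mem_outs hm')
    (inBox_of_mem_cells hL hs) (inBox_of_mem_cells hL hs') h
  refine ⟨_, hm', s, hs, ?_, ?_⟩
  · rw [nodePos, nodePos, pos_eq, pos_eq, code_inc _ _ u m]
    ring
  · rw [expo_inc, homCoeff_add_of_eq_zero hF.isMonomialIdeal u
      ((hF.mem_iff m).2 (mem_outs.1 hm).2.2.2) ((hF.notMem_iff hL s).2 hs)]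
    rw [expo_apply]
    exact Nat.eq_of_beq_eq_true hu

theorem eq_zero_of_homCoeff_gens (hF : Fits I L) (hL : boxed L = true)
    (h : ∀ m ∈ gens L, ∀ s ∈ cells L, homCoeff I (expo m) (expo s) φ = 0) : φ = 0 := by
  have key : ∀ n : ℕ, ∀ m : Pt, m.1 + m.2.1 + m.2.2 = n →
      ∀ hm : monomial (expo m) (1 : ℂ) ∈ I, φ ⟨monomial (expo m) 1, hm⟩ = 0 := by
    intro n
    induction n using Nat.strong_induction_on with
    | _ n ih =>
      intro m hmn hm
      by_cases hg : m ∈ gens L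
      · refine eq_zero_of_quotCoeff hF.isMonomialIdeal fun d hd => ?_
        rw [← homCoeff_apply hm, ← expo_mk d]
        rw [← expo_mk d, hF.notMem_iff hL] at hd
        exact h m hg _ hd
      · obtain ⟨u, q, rfl, hq⟩ := exists_dec_of_notMem_gens hL ((hF.mem_iff m).1 hm) hg
        have hqI := (hF.mem_iff q).2 hq
        have hlt : q.1 + q.2.1 + q.2.2 < n := by
          rw [← hmn]
          fin_cases u <;> simp [inc]
        have hm' := hm
        rw [expo_inc] at hm'
        have := hom_monomial_add u hqI hm' φ
        rw [ih _ hlt q rfl hqI, smul_zero] at this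
        simpa only [expo_inc] using this
  refine hom_eq_zero_of_monomial hF.isMonomialIdeal fun d hd => ?_
  have hd' := hd
  rw [← expo_mk d] at hd'
  simpa only [expo_mk] using key _ _ rfl hd'

theorem exists_homCoeff_injective (hF : Fits I L) (hL : boxed L = true) :
    ∃ B : List (Pt × Pt), B.length = upperBound L ∧
      ∀ φ : ↥I →ₗ[MvPolynomial (Fin 3) ℂ] (MvPolynomial (Fin 3) ℂ ⧸ I),
        (∀ n ∈ B, homCoeff I (expo n.1) (expo n.2) φ = 0) → φ = 0 := by
  simp only [upperBound, strict_eq]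
  obtain ⟨B, hlen, hmem, hB⟩ := exists_reps _ _ (gens L) (cells L).reverse _
  refine ⟨B, hlen, fun φ hφ => eq_zero_of_homCoeff_gens hF hL fun m hm s hs =>
    homCoeff_eq_zero_of_nodePos_mem hL (mem_outs_of_mem_gens hL hm) hs ?_⟩
  have hcl := closedUnder_vanishing (φ := φ) hF hL
  refine hB (vanishing L φ) (fun F hW => hW.flood (hcl 0) (hcl 1) (hcl 2) _) ?_ ?_ s
    (List.mem_reverse.2 hs) m hm
  · refine Sub.flood (hcl 0) (hcl 1) (hcl 2) _ fun p hp => ?_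
    rw [testBit_land, testBit_lor, testBit_lor] at hp
    obtain ⟨hp | hp | hp, hN⟩ := hp <;> exact groundMask_subset_vanishing hF hL _ hp hN
  · exact fun n hn => ⟨n.1, mem_outs_of_mem_gens hL (hmem n hn).1, n.2,
      List.mem_reverse.1 (hmem n hn).2, rfl, hφ n hn⟩

theorem finite_hom_and_tangentDim_le (hF : Fits I L) (hL : boxed L = true) :
    Module.Finite ℂ (↥I →ₗ[MvPolynomial (Fin 3) ℂ] (MvPolynomial (Fin 3) ℂ ⧸ I)) ∧
      tangentDim I ≤ upperBound L := by
  obtain ⟨B, hlen, hB⟩ := exists_homCoeff_injective hF hL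
  let Φ : (↥I →ₗ[MvPolynomial (Fin 3) ℂ] (MvPolynomial (Fin 3) ℂ ⧸ I)) →ₗ[ℂ]
      (Fin B.length → ℂ) := LinearMap.pi fun n => homCoeff I (expo B[n].1) (expo B[n].2)
  have hΦ : Function.Injective Φ := by
    rw [← LinearMap.ker_eq_bot, LinearMap.ker_eq_bot']
    refine fun φ hφ => hB φ fun n hn => ?_
    obtain ⟨i, hi, rfl⟩ := List.getElem_of_mem hn
    exact congrFun hφ ⟨i, hi⟩
  refine ⟨Module.Finite.of_injective Φ hΦ, ?_⟩
  have := LinearMap.finrank_le_finrank_of_injective hΦ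
  rwa [Module.finrank_fin_fun, hlen] at this

end Geometry

section LowerBound

/-- Equality of pairs of exponents. -/
def nodeEq (n n' : Pt × Pt) : Bool :=
  Nat.beq n.1.1 n'.1.1 && Nat.beq n.1.2.1 n'.1.2.1 && Nat.beq n.1.2.2 n'.1.2.2 &&
  Nat.beq n.2.1 n'.2.1 && Nat.beq n.2.2.1 n'.2.2.1 && Nat.beq n.2.2.2 n'.2.2.2

/-- Membership of a pair of exponents in a list. -/
def memNode (n : Pt × Pt) (C : List (Pt × Pt)) : Bool := C.any (nodeEq n)

/-- The three directions. -/
def dirs : List (Fin 3) := [0, 1, 2]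

/-- Do the pairs `(m, s)` in `C` describe the nonzero coefficients of a module homomorphism sending
each monomial to a sum of monomials? -/
def isClosed (L : List (List ℕ)) (C : List (Pt × Pt)) : Bool :=
  C.all fun n => !isStd L n.1 && isStd L n.2 && dirs.all fun u =>
    (!isStd L (inc u n.2) || memNode (inc u n.1, inc u n.2) C) &&
    (Nat.beq (get u n.1) 0 || isStd L (dec u n.1) ||
      !Nat.beq (get u n.2) 0 && memNode (dec u n.1, dec u n.2) C)

/-- The pairs at which a homomorphism has the same coefficient as at the given pair because of a
multiplication by one variable. -/
def neighbours (L : List (List ℕ)) (n : Pt × Pt) : List (Pt × Pt) :=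
  dirs.flatMap fun u =>
    (bif isStd L (inc u n.2) then [(inc u n.1, inc u n.2)] else []) ++
    (bif Nat.beq (get u n.1) 0 || isStd L (dec u n.1) then [] else [(dec u n.1, dec u n.2)])

/-- Does the coefficient at the given pair vanish for all homomorphisms because of a multiplication
by one variable? -/
def isGround (L : List (List ℕ)) (n : Pt × Pt) : Bool :=
  dirs.any fun u => !Nat.beq (get u n.1) 0 && !isStd L (dec u n.1) && Nat.beq (get u n.2) 0

/-- Depth first search: the connected component of the pairs in the given queue, or `[]` if all
coefficients at it vanish. -/
def component (L : List (List ℕ)) : ℕ → List (Pt × Pt) → List (Pt × Pt) → List (Pt × Pt)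
  | 0, _, _ => []
  | _ + 1, [], C => C
  | k + 1, n :: q, C =>
    bif memNode n C then component L k q C
    else bif isGround L n then []
    else component L k (neighbours L n ++ q) (n :: C)

/-- Is `n` in the first position among the pairs in `C`? -/
def isFirst (L : List (List ℕ)) (n : Pt × Pt) (C : List (Pt × Pt)) : Bool :=
  C.all fun n' => Nat.ble (nodePos L n.1 n.2) (nodePos L n'.1 n'.2)

/-- The connected components carrying nonzero homomorphisms, with a distinguished element. -/
def families (L : List (List ℕ)) : List ((Pt × Pt) × List (Pt × Pt)) :=
  (gens L).flatMap fun g => (cells L).filterMap fun s =>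
    match component L 1000 [(g, s)] [] with
    | [] => none
    | n :: C => bif isFirst L (g, s) (n :: C) then some ((g, s), n :: C) else none

/-- The distinguished element of a component is not in a later component. -/
def apart : List ((Pt × Pt) × List (Pt × Pt)) → Bool
  | [] => true
  | r :: l => (l.all fun r' => !memNode r.1 r'.2 && !memNode r'.1 r.2) && apart l

/-- Find at least `T` linearly independent homomorphisms. -/
def checkLower (L : List (List ℕ)) (T : ℕ) : Bool :=
  Nat.ble T (families L).length &&
  ((families L).all fun r => memNode r.1 r.2 && isClosed L r.2) && apart (families L)

theorem nodeEq_iff {n n' : Pt × Pt} : nodeEq n n' = true ↔ n = n' := by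
  obtain ⟨⟨a, b, c⟩, d, e, f⟩ := n
  obtain ⟨⟨a', b', c'⟩, d', e', f'⟩ := n'
  simp [nodeEq, and_assoc]

theorem memNode_iff {n : Pt × Pt} {C : List (Pt × Pt)} : memNode n C = true ↔ n ∈ C := by
  simp [memNode, List.any_eq_true, nodeEq_iff]

theorem isStd_iff {L : List (List ℕ)} {p : Pt} : isStd L p = true ↔ p.2.2 < ht L p.1 p.2.1 := by
  simp [isStd]

theorem isStd_eq_false_iff {L : List (List ℕ)} {p : Pt} :
    isStd L p = false ↔ ht L p.1 p.2.1 ≤ p.2.2 := by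
  rw [← not_lt, ← isStd_iff, Bool.not_eq_true]

theorem dec_inc (u : Fin 3) (p : Pt) : dec u (inc u p) = p := by
  fin_cases u <;> rfl

theorem get_inc (u : Fin 3) (p : Pt) : get u (inc u p) = get u p + 1 := by
  fin_cases u <;> rfl

theorem inc_dec {u : Fin 3} {p : Pt} (h : get u p ≠ 0) : inc u (dec u p) = p := by
  obtain ⟨i, j, k⟩ := p
  fin_cases u <;> exact Prod.ext (by simp_all [inc, dec, get, Nat.sub_one_add_one])
    (Prod.ext (by simp_all [inc, dec, get, Nat.sub_one_add_one])
      (by simp_all [inc, dec, get, Nat.sub_one_add_one]))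

variable {I : Ideal (MvPolynomial (Fin 3) ℂ)} {L : List (List ℕ)} {C : List (Pt × Pt)}

theorem inc_mem_of_isClosed (hC : isClosed L C = true) {m s : Pt} (h : (m, s) ∈ C) {u : Fin 3}
    (hs : inc u s ∈ cells L) (hL : boxed L = true) : (inc u m, inc u s) ∈ C := by
  rw [mem_cells hL, ← isStd_iff] at hs
  have := List.all_eq_true.1 hC _ h
  simp only [Bool.and_eq_true, List.all_eq_true] at this
  have := (this.2 u (by fin_cases u <;> simp [dirs])).1
  simpa [hs, memNode_iff] using this

theorem dec_mem_of_isClosed (hC : isClosed L C = true) {m t : Pt} {u : Fin 3}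
    (h : (inc u m, t) ∈ C) (hm : ht L m.1 m.2.1 ≤ m.2.2) : get u t ≠ 0 ∧ (m, dec u t) ∈ C := by
  rw [← isStd_eq_false_iff] at hm
  have := List.all_eq_true.1 hC _ h
  simp only [Bool.and_eq_true, List.all_eq_true] at this
  have := (this.2 u (by fin_cases u <;> simp [dirs])).2
  have : Nat.beq (get u t) 0 = false ∧ (m, dec u t) ∈ C := by
    simpa [hm, memNode_iff, dec_inc, get_inc] using this
  exact ⟨Nat.ne_of_beq_eq_false this.1, this.2⟩

/-- The linear map that sends the monomial with exponent `m` to the sum of the classes of the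
monomials with exponent `s` for `(m, s)` in `C`. -/
noncomputable def linearOf (I : Ideal (MvPolynomial (Fin 3) ℂ)) (C : List (Pt × Pt)) :
    MvPolynomial (Fin 3) ℂ →ₗ[ℂ] (MvPolynomial (Fin 3) ℂ ⧸ I) :=
  (basisMonomials (Fin 3) ℂ).constr ℂ fun d =>
    ∑ n ∈ C.toFinset with n.1 = (d 0, d 1, d 2),
      Ideal.Quotient.mk I (monomial (expo n.2) (1 : ℂ))

theorem quotCoeff_linearOf (hF : Fits I L) (hL : boxed L = true) (C : List (Pt × Pt)) (m : Pt)
    {t : Pt} (ht : t ∈ cells L) : quotCoeff I (expo t) (linearOf I C (monomial (expo m) 1)) =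
      if (m, t) ∈ C then 1 else 0 := by
  have hm : ((expo m) 0, (expo m) 1, (expo m) 2) = m := expo_injective (expo_mk _)
  have h1 : linearOf I C (monomial (expo m) 1) = ∑ n ∈ C.toFinset with n.1 = m,
      Ideal.Quotient.mk I (monomial (expo n.2) (1 : ℂ)) := by
    have := (basisMonomials (Fin 3) ℂ).constr_basis ℂ (fun d : Fin 3 →₀ ℕ =>
      ∑ n ∈ C.toFinset with n.1 = (d 0, d 1, d 2),
        Ideal.Quotient.mk I (monomial (expo n.2) (1 : ℂ))) (expo m)
    rwa [coe_basisMonomials, hm] at this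
  rw [h1, map_sum]
  simp only [quotCoeff_mk hF.isMonomialIdeal ((hF.notMem_iff hL t).2 ht), coeff_monomial,
    expo_injective.eq_iff]
  split_ifs with h
  · rw [Finset.sum_eq_single_of_mem (m, t) (by simp [h]), if_pos rfl]
    exact fun n hn hne => if_neg fun hs => hne (Prod.ext (Finset.mem_filter.1 hn).2 hs)
  · refine Finset.sum_eq_zero fun n hn => if_neg fun hs => h ?_
    obtain ⟨hn, hm⟩ := Finset.mem_filter.1 hn
    rw [← hs, ← hm]
    exact List.mem_toFinset.1 hn

theorem linearOf_inc (hF : Fits I L) (hL : boxed L = true) (hC : isClosed L C = true) {m : Pt}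
    (hm : ht L m.1 m.2.1 ≤ m.2.2) (u : Fin 3) : linearOf I C (monomial (expo (inc u m)) 1) =
      (X u : MvPolynomial (Fin 3) ℂ) • linearOf I C (monomial (expo m) 1) := by
  rw [← sub_eq_zero]
  refine eq_zero_of_quotCoeff hF.isMonomialIdeal fun d hd => ?_
  obtain ⟨t, rfl⟩ : ∃ t, expo t = d := ⟨_, expo_mk d⟩
  have ht := (hF.notMem_iff hL t).1 hd
  rw [map_sub, sub_eq_zero, quotCoeff_linearOf hF hL C _ ht]
  by_cases hu : get u t = 0
  · rw [quotCoeff_X_smul_of_eq_zero hF.isMonomialIdeal u hd (by rw [expo_apply, hu])]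
    exact if_neg fun h => (dec_mem_of_isClosed hC h hm).1 hu
  · obtain ⟨s, rfl⟩ : ∃ s, inc u s = t := ⟨_, inc_dec hu⟩
    have hs : s ∈ cells L := by
      rw [← hF.notMem_iff hL]
      refine fun h => hd ?_
      rw [expo_inc]
      exact monomial_mem_of_le le_self_add h
    rw [expo_inc] at hd ⊢
    rw [quotCoeff_X_smul_add hF.isMonomialIdeal u hd, quotCoeff_linearOf hF hL C _ hs]
    refine if_congr ⟨fun h => ?_, fun h => inc_mem_of_isClosed hC h ht hL⟩ rfl rfl
    simpa only [dec_inc] using (dec_mem_of_isClosed hC h hm).2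

theorem exists_hom_of_isClosed (hF : Fits I L) (hL : boxed L = true) (hC : isClosed L C = true) :
    ∃ φ : ↥I →ₗ[MvPolynomial (Fin 3) ℂ] (MvPolynomial (Fin 3) ℂ ⧸ I),
      ∀ m s, ht L m.1 m.2.1 ≤ m.2.2 → s ∈ cells L →
        homCoeff I (expo m) (expo s) φ = if (m, s) ∈ C then 1 else 0 := by
  obtain ⟨φ, hφ⟩ := exists_hom_of_forall_monomial hF.isMonomialIdeal (linearOf I C) fun d hd u => by
    obtain ⟨m, rfl⟩ : ∃ m, expo m = d := ⟨_, expo_mk d⟩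
    rw [← expo_inc]
    exact linearOf_inc hF hL hC ((hF.mem_iff m).1 hd) u
  refine ⟨φ, fun m s hm hs => ?_⟩
  rw [homCoeff_apply ((hF.mem_iff m).2 hm), hφ, quotCoeff_linearOf hF hL C m hs]

theorem apart_iff {l : List ((Pt × Pt) × List (Pt × Pt))} :
    apart l = true ↔ l.Pairwise fun r r' => r.1 ∉ r'.2 ∧ r'.1 ∉ r.2 := by
  induction l with
  | nil => simp [apart]
  | cons r l ih =>
    simp [apart, ih, List.all_eq_true, ← memNode_iff]

theorem le_tangentDim (hF : Fits I L) (hL : boxed L = true) {T : ℕ}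
    (h : checkLower L T = true) : T ≤ tangentDim I := by
  have := (finite_hom_and_tangentDim_le hF hL).1
  simp only [checkLower, Bool.and_eq_true, Nat.ble_eq, List.all_eq_true, memNode_iff] at h
  obtain ⟨⟨hT, hcl⟩, hap⟩ := h
  rw [apart_iff] at hap
  set l := families L
  choose ψ hψ using fun i : Fin l.length =>
    exists_hom_of_isClosed hF hL (hcl l[i] (List.getElem_mem i.2)).2
  have key : ∀ i j : Fin l.length,
      homCoeff I (expo l[j].1.1) (expo l[j].1.2) (ψ i) = if i = j then 1 else 0 := by
    intro i j
    obtain ⟨hj, hjc⟩ := hcl l[j] (List.getElem_mem j.2)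
    have hn := List.all_eq_true.1 hjc _ hj
    simp only [Bool.and_eq_true, Bool.not_eq_true', isStd_iff, isStd_eq_false_iff] at hn
    rw [hψ i _ _ hn.1.1 ((mem_cells hL).2 hn.1.2)]
    refine if_congr ⟨fun h => ?_, fun h => h ▸ hj⟩ rfl rfl
    rcases lt_trichotomy i j with hij | hij | hij
    · exact absurd h (List.pairwise_iff_getElem.1 hap i j i.2 j.2 hij).2
    · exact hij
    · exact absurd h (List.pairwise_iff_getElem.1 hap j i j.2 i.2 hij).1
  have hli : LinearIndependent ℂ ψ := by
    rw [Fintype.linearIndependent_iff]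
    intro g hg j
    have := congrArg (homCoeff I (expo l[j].1.1) (expo l[j].1.2)) hg
    rw [map_sum, map_zero] at this
    simpa only [map_smul, key, smul_eq_mul, mul_ite, mul_one, mul_zero, Finset.sum_ite_eq',
      Finset.mem_univ, if_true] using this
  have := hli.fintype_card_le_finrank
  rw [Fintype.card_fin] at this
  exact hT.trans this

end LowerBound

section Shapes

variable {I : Ideal (MvPolynomial (Fin 3) ℂ)} {L : List (List ℕ)} {H : ℕ → ℕ → ℕ}

theorem card_standard {a b : ℕ}
    (hI : ∀ p : Pt, monomial (expo p) (1 : ℂ) ∈ I ↔ H p.1 p.2.1 ≤ p.2.2)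
    (ha : ∀ i j, a ≤ i → H i j = 0) (hb : ∀ i j, b ≤ j → H i j = 0) :
    Nat.card {s : Fin 3 →₀ ℕ // monomial s (1 : ℂ) ∉ I} =
      ∑ i ∈ Finset.range a, ∑ j ∈ Finset.range b, H i j := by
  classical
  let e : (Σ _ : ℕ, Σ _ : ℕ, ℕ) → (Fin 3 →₀ ℕ) := fun x => expo (x.1, x.2.1, x.2.2)
  have he : Function.Injective e := by
    rintro ⟨i, j, k⟩ ⟨i', j', k'⟩ h
    obtain ⟨rfl, rfl, rfl⟩ : i = i' ∧ j = j' ∧ k = k' := by simpa using expo_injective h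
    rfl
  rw [Nat.subtype_card (((Finset.range a).sigma fun i => (Finset.range b).sigma fun j =>
    Finset.range (H i j)).image e), Finset.card_image_of_injective _ he]
  · simp [Finset.card_sigma]
  · intro d
    obtain ⟨p, rfl⟩ : ∃ p, expo p = d := ⟨_, expo_mk d⟩
    rw [hI, not_le, Finset.mem_image]
    constructor
    · rintro ⟨x, hx, h⟩
      obtain rfl := expo_injective h
      simp only [Finset.mem_sigma, Finset.mem_range] at hx
      exact hx.2.2
    · intro hp
      refine ⟨⟨p.1, p.2.1, p.2.2⟩, ?_, rfl⟩
      simp only [Finset.mem_sigma, Finset.mem_range]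
      refine ⟨?_, ?_, hp⟩
      · by_contra h
        rw [ha _ _ (not_lt.1 h)] at hp
        omega
      · by_contra h
        rw [hb _ _ (not_lt.1 h)] at hp
        omega

/-- Column heights of the staircase of a Borel-fixed ideal. -/
structure IsBorelShape (H : ℕ → ℕ → ℕ) : Prop where
  row (i j : ℕ) : H i (j + 1) ≤ H i j - 1
  diag (i j : ℕ) : H (i + 1) j ≤ H i (j + 1)

theorem IsBorelShape.le_sub (hH : IsBorelShape H) (i j : ℕ) : H i j ≤ H i 0 - j := by
  induction j with
  | zero => exact le_rfl
  | succ j ih =>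
    have := hH.row i j
    omega

theorem IsBorelShape.succ_le_sub (hH : IsBorelShape H) (i j : ℕ) : H (i + 1) j ≤ H i j - 1 :=
  (hH.diag i j).trans (hH.row i j)

theorem IsBorelShape.antitone_left (hH : IsBorelShape H) (j : ℕ) : Antitone fun i => H i j :=
  antitone_nat_of_succ_le fun i => (hH.succ_le_sub i j).trans (Nat.sub_le _ _)

theorem IsBorelShape.antitone_right (hH : IsBorelShape H) (i : ℕ) : Antitone (H i) :=
  antitone_nat_of_succ_le fun j => (hH.row i j).trans (Nat.sub_le _ _)

theorem isBorelFixed_of_isBorelShape (hH : IsBorelShape H)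
    (hI : ∀ p : Pt, monomial (expo p) (1 : ℂ) ∈ I ↔ H p.1 p.2.1 ≤ p.2.2) : IsBorelFixed I := by
  intro d hd i j hij hj
  obtain ⟨p, rfl⟩ : ∃ p, expo p = d := ⟨_, expo_mk d⟩
  rw [expo_apply] at hj
  obtain ⟨q, rfl⟩ : ∃ q, inc j q = p := ⟨_, inc_dec hj.ne'⟩
  have e : expo (inc j q) + Finsupp.single i 1 - Finsupp.single j 1 = expo (inc i q) := by
    rw [expo_inc, expo_inc, add_right_comm, add_tsub_cancel_right]
  rw [e, hI]
  rw [hI] at hd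
  obtain ⟨x, y, z⟩ := q
  have h1 := hH.row x y
  have h2 := hH.diag x y
  have h3 := hH.succ_le_sub x y
  fin_cases i <;> fin_cases j <;> simp [inc] at hij hd ⊢ <;> omega

/-- The monomial ideal whose standard monomials are given by the column heights `L`. -/
noncomputable def idealOf (L : List (List ℕ)) : Ideal (MvPolynomial (Fin 3) ℂ) :=
  Ideal.span ((fun d => monomial d (1 : ℂ)) '' {d : Fin 3 →₀ ℕ | ht L (d 0) (d 1) ≤ d 2})

theorem mem_idealOf (hL : IsBorelShape (ht L)) {f : MvPolynomial (Fin 3) ℂ} :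
    f ∈ idealOf L ↔ ∀ d ∈ f.support, ht L (d 0) (d 1) ≤ d 2 := by
  rw [idealOf, mem_ideal_span_monomial_image]
  refine forall₂_congr fun d _ => ⟨?_, fun h => ⟨d, h, le_rfl⟩⟩
  rintro ⟨s, hs, hsd⟩
  exact (((hL.antitone_right _ (hsd 1)).trans (hL.antitone_left _ (hsd 0))).trans hs).trans (hsd 2)

theorem fits_idealOf (hL : IsBorelShape (ht L)) : Fits (idealOf L) L where
  isMonomialIdeal f hf d hd := by
    rw [mem_idealOf hL] at hf ⊢
    intro s hs
    rw [Finset.mem_singleton.1 (support_monomial_subset hs)]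
    exact hf d hd
  mem_iff p := by
    rw [mem_idealOf hL, support_monomial, if_neg one_ne_zero]
    simp only [Finset.mem_singleton, forall_eq, expo_apply]
    rfl

theorem X_pow_eq_monomial_expo (n : ℕ) :
    (X 0 : MvPolynomial (Fin 3) ℂ) ^ n = monomial (expo (n, 0, 0)) 1 := by
  have : expo (n, 0, 0) = Finsupp.single 0 n := by
    ext u
    rw [expo_apply]
    fin_cases u <;> simp [get]
  rw [X_pow_eq_monomial, this]

theorem exists_heights [Finite {s : Fin 3 →₀ ℕ // monomial s (1 : ℂ) ∉ I}] (hB : IsBorelFixed I) :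
    ∃ H, IsBorelShape H ∧ ∀ p : Pt, monomial (expo p) (1 : ℂ) ∈ I ↔ H p.1 p.2.1 ≤ p.2.2 := by
  classical
  have hex : ∀ i j, ∃ k, monomial (expo (i, j, k)) (1 : ℂ) ∈ I := by
    intro i j
    by_contra! h
    refine not_injective_infinite_finite
      (fun k : ℕ => (⟨_, h k⟩ : {s : Fin 3 →₀ ℕ // monomial s (1 : ℂ) ∉ I})) fun k k' hk => ?_
    have := expo_injective (Subtype.ext_iff.1 hk)
    simpa using this
  have hinc : ∀ u p, monomial (expo p) (1 : ℂ) ∈ I → monomial (expo (inc u p)) (1 : ℂ) ∈ I :=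
    fun u p h => expo_inc u p ▸ monomial_mem_of_le le_self_add h
  have hmove : ∀ i j : Fin 3, i < j → ∀ q, monomial (expo (inc j q)) (1 : ℂ) ∈ I →
      monomial (expo (inc i q)) (1 : ℂ) ∈ I := by
    intro i j hij q hq
    have := hB _ hq i j hij (by rw [expo_apply, get_inc]; omega)
    rwa [expo_inc, add_right_comm, add_tsub_cancel_right, ← expo_inc] at this
  have hI : ∀ p : Pt, monomial (expo p) (1 : ℂ) ∈ I ↔ Nat.find (hex p.1 p.2.1) ≤ p.2.2 := by
    intro p
    refine ⟨fun h => Nat.find_min' _ h, fun h => ?_⟩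
    have hmono : ∀ k, Nat.find (hex p.1 p.2.1) ≤ k → monomial (expo (p.1, p.2.1, k)) (1 : ℂ) ∈ I :=
      fun k hk => Nat.le_induction (Nat.find_spec (hex p.1 p.2.1))
        (fun k _ ih => hinc 2 (p.1, p.2.1, k) ih) k hk
    exact hmono _ h
  refine ⟨fun i j => Nat.find (hex i j), ⟨fun i j => ?_, fun i j => ?_⟩, hI⟩
  · have h := Nat.find_spec (hex i j)
    refine Nat.find_min' _ ?_
    cases hk : Nat.find (hex i j) with
    | zero =>
      rw [hk] at h
      exact hinc 1 (i, j, 0) h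
    | succ k =>
      rw [hk] at h
      exact hmove 1 2 (by decide) (i, j, k) h
  · exact Nat.find_min' _ (hmove 0 1 (by decide) (i, j, _) (Nat.find_spec (hex i (j + 1))))

end Shapes

section Enumeration

/-- Nonempty strictly decreasing rows with entries at most `b` and at most those of the first
argument, and sum at most `n`. -/
def rows : List ℕ → ℕ → ℕ → List (List ℕ)
  | [], _, _ => [[]]
  | p :: ps, b, n =>
    [] :: (List.range (min (min p b) n)).flatMap fun k =>
      (rows ps k (n - (k + 1))).map fun r => (k + 1) :: r

/-- Check the upper bound `T` for all staircases of size `n` with `d` layers lying on top of the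
layers `acc`, the last one of which has the tail `prev`. -/
def checkUpper (b T : ℕ) : ℕ → List (List ℕ) → List ℕ → ℕ → Bool
  | 0, acc, _, n => !Nat.beq n 0 || (boxed acc && Nat.ble (upperBound acc) T)
  | d + 1, acc, prev, n => (rows prev b n).all fun r =>
      Nat.beq r.length 0 || checkUpper b T d (acc ++ [r]) r.tail (n - r.sum)

theorem exists_mem_rows {f : ℕ → ℕ} (hf : ∀ j, f (j + 1) ≤ f j - 1) (ps : List ℕ)
    (hps : ∀ j, f j ≤ ps.getD j 0) {b n : ℕ} (hb : f 0 ≤ b)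
    (hn : ∀ m, ∑ j ∈ Finset.range m, f j ≤ n) : ∃ r ∈ rows ps b n, ∀ j, r.getD j 0 = f j := by
  induction ps generalizing f b n with
  | nil => exact ⟨[], by simp [rows], fun j => (Nat.le_zero.1 (hps j)).symm⟩
  | cons p ps ih =>
    cases hk : f 0 with
    | zero =>
      refine ⟨[], by simp [rows], fun j => ?_⟩
      induction j with
      | zero => simp [hk]
      | succ j hj =>
        have := hf j
        simp at hj ⊢
        omega
    | succ k =>
      have hp := hps 0
      have hn0 := hn 1
      rw [List.getD_cons_zero] at hp
      rw [Finset.sum_range_one] at hn0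
      obtain ⟨r, hr, h⟩ := ih (f := fun j => f (j + 1)) (b := k) (n := n - (k + 1))
        (fun j => hf _) (fun j => by simpa using hps (j + 1)) (by have := hf 0; omega) fun m => by
          have := hn (m + 1)
          rw [Finset.sum_range_succ', hk] at this
          omega
      refine ⟨(k + 1) :: r, ?_, fun j => ?_⟩
      · rw [rows]
        refine List.mem_cons_of_mem _ (List.mem_flatMap.2 ⟨k, ?_, List.mem_map_of_mem hr⟩)
        rw [List.mem_range]
        omega
      · cases j with
        | zero => simp [hk]
        | succ j => simpa using h j

theorem sum_range_getD (r : List ℕ) {m : ℕ} (h : ∀ j, m ≤ j → r.getD j 0 = 0) :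
    ∑ j ∈ Finset.range m, r.getD j 0 = r.sum := by
  induction r generalizing m with
  | nil => simp
  | cons k r ih =>
    cases m with
    | zero =>
      have h1 := ih (m := 0) fun j _ => by simpa using h (j + 1) (Nat.zero_le _)
      have h2 := h 0 le_rfl
      simp at h1 h2 ⊢
      omega
    | succ m =>
      have h1 := ih (m := m) fun j hj => by simpa using h (j + 1) (by omega)
      rw [Finset.sum_range_succ', List.sum_cons, ← h1, add_comm]
      simp

theorem exists_staircase {b c T d : ℕ} (acc : List (List ℕ)) (prev : List ℕ) {n : ℕ}
    (hc : checkUpper b T d acc prev n = true) {H : ℕ → ℕ → ℕ} (hH : IsBorelShape H)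
    (hd : ∀ i j, d ≤ i → H i j = 0) (hpos : ∀ i < d, 0 < H i 0) (hcol : ∀ i j, c ≤ j → H i j = 0)
    (hb : H 0 0 ≤ b) (hprev : ∀ j, H 0 j ≤ prev.getD j 0)
    (hn : ∑ i ∈ Finset.range d, ∑ j ∈ Finset.range c, H i j = n) :
    ∃ L : List (List ℕ), (∀ i j, ht L i j = H i j) ∧ boxed (acc ++ L) = true ∧
      upperBound (acc ++ L) ≤ T := by
  induction d generalizing H acc prev n with
  | zero =>
    rw [Finset.sum_range_zero] at hn
    subst hn
    refine ⟨[], fun i j => ?_, ?_⟩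
    · rw [hd i j (Nat.zero_le _)]
      rfl
    · simpa [checkUpper] using hc
  | succ d ih =>
    rw [Finset.sum_range_succ'] at hn
    have hsum : ∀ m, ∑ j ∈ Finset.range m, H 0 j ≤ ∑ j ∈ Finset.range c, H 0 j := fun m =>
      Finset.sum_le_sum_of_ne_zero fun j _ hj => by
        rw [Finset.mem_range]
        by_contra hjc
        exact hj (hcol 0 j (not_lt.1 hjc))
    obtain ⟨r, hr, hrH⟩ := exists_mem_rows (hH.row 0) prev hprev hb
      fun m => (hsum m).trans (hn ▸ Nat.le_add_left _ _)
    rw [checkUpper, List.all_eq_true] at hc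
    have hrc := hc r hr
    have hlen : r.length ≠ 0 := by
      rintro h
      have := hrH 0
      have := hpos 0 (Nat.succ_pos d)
      rw [List.length_eq_zero_iff.1 h] at *
      simp at *
      omega
    rw [Bool.or_eq_true, Nat.beq_eq, or_iff_right hlen] at hrc
    have hrsum : r.sum = ∑ j ∈ Finset.range c, H 0 j := by
      rw [← sum_range_getD r fun j hj => (hrH j).trans (hcol 0 j hj)]
      exact Finset.sum_congr rfl fun j _ => hrH j
    obtain ⟨L, hL, h⟩ := ih (acc ++ [r]) r.tail hrc (H := fun i => H (i + 1))
      ⟨fun i => hH.row (i + 1), fun i => hH.diag (i + 1)⟩ (fun i j hi => hd _ j (by omega))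
      (fun i hi => hpos _ (by omega)) (fun i => hcol _)
      ((hH.antitone_left 0 (Nat.zero_le 1)).trans hb)
      (fun j => by
        have := hrH (j + 1)
        cases r with
        | nil => simp at hlen
        | cons k r =>
          rw [List.getD_cons_succ] at this
          rw [List.tail_cons, this]
          exact hH.diag 0 j)
      (by omega)
    refine ⟨r :: L, fun i j => ?_, by simpa using h⟩
    cases i with
    | zero => simpa [ht] using hrH j
    | succ i => simpa [ht] using hL i j

theorem tangentDim_le_of_checkUpper {I : Ideal (MvPolynomial (Fin 3) ℂ)} {l d T : ℕ} (hl : 0 < l)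
    (hd : 0 < d) (hc : checkUpper l T d [] (List.replicate l l) l = true) (hI : IsMonomialIdeal I)
    (hB : IsBorelFixed I) (hrank : Module.finrank ℂ (MvPolynomial (Fin 3) ℂ ⧸ I) = l)
    (hX : (X 0 : MvPolynomial (Fin 3) ℂ) ^ d ∈ I)
    (hX' : (X 0 : MvPolynomial (Fin 3) ℂ) ^ (d - 1) ∉ I) : tangentDim I ≤ T := by
  rw [finrank_quotient_eq_card hI] at hrank
  have : Finite {s : Fin 3 →₀ ℕ // monomial s (1 : ℂ) ∉ I} :=
    Nat.finite_of_card_ne_zero (by omega)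
  obtain ⟨H, hH, hHI⟩ := exists_heights hB
  rw [X_pow_eq_monomial_expo, hHI] at hX hX'
  simp only at hX hX'
  have hzero : ∀ i j, d ≤ i → H i j = 0 := fun i j hi => by
    have h1 := hH.antitone_left 0 hi
    have h2 := hH.antitone_right i (Nat.zero_le j)
    simp only at h1
    omega
  have hcol : ∀ i j, H 0 0 ≤ j → H i j = 0 := fun i j hj => by
    have h1 := hH.antitone_left 0 (Nat.zero_le i)
    have h2 := hH.le_sub i j
    simp only at h1
    omega
  have hpos : ∀ i < d, 0 < H i 0 := fun i hi => by
    have := hH.antitone_left 0 (show i ≤ d - 1 by omega)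
    simp only at this
    omega
  rw [card_standard hHI hzero hcol] at hrank
  have hle : H 0 0 ≤ l := by
    have h1 := Finset.single_le_sum (f := fun j => H 0 j) (fun j _ => Nat.zero_le _)
      (Finset.mem_range.2 (hpos 0 hd))
    have h2 := Finset.single_le_sum (f := fun i => ∑ j ∈ Finset.range (H 0 0), H i j)
      (fun j _ => Nat.zero_le _) (Finset.mem_range.2 hd)
    rw [hrank] at h2
    exact h1.trans h2
  obtain ⟨L, hL, hbox, hT⟩ := exists_staircase [] _ hc hH hzero hpos hcol hle (fun j => by
    have := hH.le_sub 0 j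
    rcases lt_or_ge j l with hj | hj
    · rw [List.getD_replicate _ hj]
      omega
    · omega) hrank
  have hF : Fits I L := ⟨hI, fun p => by rw [hHI, hL]⟩
  exact (finite_hom_and_tangentDim_le hF hbox).2.trans hT

/-- Check that the column heights in `L` describe a Borel-fixed ideal. -/
def checkShape (L : List (List ℕ)) : Bool :=
  boxed L && (List.range (xDim L)).all fun i => (List.range (yDim L)).all fun j =>
    Nat.ble (ht L (i + 1) j) (ht L i (j + 1)) && Nat.ble (ht L i (j + 1)) (ht L i j - 1)

theorem isBorelShape_of_checkShape {L : List (List ℕ)} (h : checkShape L = true) :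
    IsBorelShape (ht L) := by
  simp only [checkShape, Bool.and_eq_true, List.all_eq_true, List.mem_range, Nat.ble_eq] at h
  have key : ∀ i j, ht L (i + 1) j ≤ ht L i (j + 1) ∧ ht L i (j + 1) ≤ ht L i j - 1 := by
    intro i j
    rcases lt_or_ge i (xDim L) with hi | hi
    · rcases lt_or_ge j (yDim L) with hj | hj
      · exact h.2 i hi j hj
      · rw [ht_eq_zero_of_yDim_le h.1 _ hj, ht_eq_zero_of_yDim_le h.1 _ (hj.trans j.le_succ)]
        exact ⟨Nat.zero_le _, Nat.zero_le _⟩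
    · rw [ht_eq_zero_of_xDim_le (hi.trans i.le_succ), ht_eq_zero_of_xDim_le hi]
      exact ⟨Nat.zero_le _, Nat.zero_le _⟩
  exact ⟨fun i j => (key i j).2, fun i j => (key i j).1⟩

theorem tmaxEq_of_check {l d T : ℕ} {L : List (List ℕ)} (hl : 0 < l) (hd : 0 < d)
    (hupper : checkUpper l T d [] (List.replicate l l) l = true) (hshape : checkShape L = true)
    (hlower : checkLower L T = true) (hx : ht L d 0 = 0) (hx' : 0 < ht L (d - 1) 0)
    (hsum : ∑ i ∈ Finset.range (xDim L), ∑ j ∈ Finset.range (yDim L), ht L i j = l) :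
    TmaxEq l d T := by
  have hL := isBorelShape_of_checkShape hshape
  have hbox : boxed L = true := (Bool.and_eq_true _ _ ▸ hshape :).1
  have hF := fits_idealOf hL
  have hB := isBorelFixed_of_isBorelShape hL hF.mem_iff
  have hrank : Module.finrank ℂ (MvPolynomial (Fin 3) ℂ ⧸ idealOf L) = l := by
    rw [finrank_quotient_eq_card hF.isMonomialIdeal, ← hsum]
    exact card_standard hF.mem_iff (fun i j hi => ht_eq_zero_of_xDim_le hi j)
      fun i j hj => ht_eq_zero_of_yDim_le hbox i hj
  have hX : (X 0 : MvPolynomial (Fin 3) ℂ) ^ d ∈ idealOf L := by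
    rw [X_pow_eq_monomial_expo, hF.mem_iff]
    exact hx.le
  have hX' : (X 0 : MvPolynomial (Fin 3) ℂ) ^ (d - 1) ∉ idealOf L := by
    rw [X_pow_eq_monomial_expo, hF.mem_iff, not_le]
    exact hx'
  refine ⟨⟨idealOf L, hF.isMonomialIdeal, hB, hrank, hX, hX', le_antisymm ?_ ?_⟩, ?_⟩
  · exact le_tangentDim hF hbox hlower
  · exact tangentDim_le_of_checkUpper hl hd hupper hF.isMonomialIdeal hB hrank hX hX'
  · rintro _ ⟨J, hJ, hJB, hJl, hJX, hJX', rfl⟩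
    exact tangentDim_le_of_checkUpper hl hd hupper hJ hJB hJl hJX hJX'

end Enumeration

end Staircase

open Staircase

theorem Tmax_monotonicity_l18 :
    TmaxEq 18 2 86 ∧
    TmaxEq 18 3 102 ∧
    (∀ T1 T2 T3 : ℕ, TmaxEq 18 1 T1 → TmaxEq 18 2 T2 → TmaxEq 18 3 T3 →
      T1 < T2 ∧ T2 < T3) := by
  have h2 : TmaxEq 18 2 86 := tmaxEq_of_check (L := [[6, 4, 2], [4, 2]]) (by decide) (by decide)
    (by decide +kernel) (by decide +kernel) (by decide +kernel) rfl (by decide) (by decide +kernel)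
  have h3 : TmaxEq 18 3 102 := tmaxEq_of_check (L := [[5, 3, 2, 1], [3, 2, 1], [1]]) (by decide)
    (by decide) (by decide +kernel) (by decide +kernel) (by decide +kernel) rfl (by decide)
    (by decide +kernel)
  refine ⟨h2, h3, fun T1 T2 T3 H1 H2 H3 => ?_⟩
  obtain ⟨I, hI, hB, hl, hX, hX', rfl⟩ := H1.1
  have h1 : tangentDim I ≤ 85 := tangentDim_le_of_checkUpper (by decide) (by decide)
    (by decide +kernel) hI hB hl hX hX'
  rw [H2.unique h2, H3.unique h3]
  omega
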